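/- arXiv:2112.14839 — 2 statements merged into one kernel-verified Lean document; each statement's English description precedes it below -/
import Mathlib

section
/- Let d ≥ 3, let ρ be a probability density on ℝ^d with ρ₁ > 0 almost everywhere, and let g₁₁ be a constant. Assume: ρ_{∖2} is twice continuously differentiable in x₁ with ∂²ρ_{∖2}/∂x₁² integrable on ℝ^{d-1}; differentiation under the integral sign is valid so that ∂²ρ₁/∂x₁²(x₁) = ∫_{ℝ^{d-2}} ∂²ρ_{∖2}/∂x₁² dx₃⋯dx_d; ∂ρ₁/∂x₁ tends to 0 as x₁ → ±∞; and ρ_{2|1}·∂²ρ_{∖2}/∂x₁² is integrable on ℝ^d. Then the diffusion contribution to the information flow vanishes: (1/2)∫_{ℝ^d} ρ_{2|1}(x₂|x₁) ∂²(g₁₁ρ_{∖2})/∂x₁² dx = 0. -/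
open MeasureTheory Filter

noncomputable section

/-- Marginal density of the first coordinate. -/
def rho1 {m : ℕ} (ρ : ℝ × ℝ × (Fin m → ℝ) → ℝ) (x₁ : ℝ) : ℝ :=
  ∫ p : ℝ × (Fin m → ℝ), ρ (x₁, p)

/-- Joint marginal density of the first two coordinates. -/
def rho12 {m : ℕ} (ρ : ℝ × ℝ × (Fin m → ℝ) → ℝ) (x₁ x₂ : ℝ) : ℝ :=
  ∫ y : Fin m → ℝ, ρ (x₁, x₂, y)

/-- Conditional density of the second coordinate given the first. -/
def rho2c {m : ℕ} (ρ : ℝ × ℝ × (Fin m → ℝ) → ℝ) (x₁ x₂ : ℝ) : ℝ :=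
  rho12 ρ x₁ x₂ / rho1 ρ x₁

/-- Marginal density with x₂ integrated out. -/
def rhoM2 {m : ℕ} (ρ : ℝ × ℝ × (Fin m → ℝ) → ℝ) (x₁ : ℝ) (y : Fin m → ℝ) : ℝ :=
  ∫ x₂ : ℝ, ρ (x₁, x₂, y)

/-- If `u` is integrable and its derivative has a limit along a filter whose sets have infinite measure
and which absorbs bounded forward shifts, that limit is zero. -/
theorem limit_deriv_zero_aux (u : ℝ → ℝ) (hu : ContDiff ℝ 2 u) (hi : Integrable u)
    (l : Filter ℝ) (hl : ∀ s ∈ l, volume s = ⊤) (L : ℝ)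
    (hsh : ∀ ξ : ℝ → ℝ, (∀ x, x < ξ x ∧ ξ x < x + 1) → Tendsto ξ l l)
    (hL : Tendsto (deriv u) l (nhds L)) : L = 0 := by
  have hd : Differentiable ℝ u := hu.differentiable (by norm_num)
  have key : ∀ x : ℝ, ∃ c, (x < c ∧ c < x + 1) ∧ deriv u c = u (x + 1) - u x := by
    intro x
    obtain ⟨c, hc, h⟩ := exists_deriv_eq_slope u (show x < x + 1 by linarith)
      hd.continuous.continuousOn hd.differentiableOn
    exact ⟨c, ⟨hc.1, hc.2⟩, by rw [h]; simp⟩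
  choose ξ h1 h2 using key
  have ht : Tendsto (fun x => u (x + 1) - u x) l (nhds L) := by
    have := hL.comp (hsh ξ h1)
    refine this.congr (fun x => ?_)
    simp [h2]
  have hdiff : Integrable (fun x => u (x + 1) - u x) := (hi.comp_add_right 1).sub hi
  exact (hdiff.integrableAtFilter l).eq_zero_of_tendsto hl ht

theorem integral_second_deriv_zero_aux (u : ℝ → ℝ) (hu : ContDiff ℝ 2 u) (hi : Integrable u)
    (hi2 : Integrable (deriv (deriv u))) : ∫ x, deriv (deriv u) x = 0 := by
  have hd1 : ContDiff ℝ 1 (deriv u) := by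
    have : ContDiff ℝ (1 + 1) u := by simpa [one_add_one_eq_two] using hu
    exact (contDiff_succ_iff_deriv.1 this).2.2
  have hd : ∀ x, HasDerivAt (deriv u) (deriv (deriv u) x) x := fun x =>
    ((hd1.differentiable (by norm_num)) x).hasDerivAt
  have t1 := tendsto_limUnder_of_hasDerivAt_of_integrableOn_Ioi (a := 0) (fun x _ => hd x)
    hi2.integrableOn
  have t2 := tendsto_limUnder_of_hasDerivAt_of_integrableOn_Iic (a := 0) (fun x _ => hd x)
    hi2.integrableOn
  have e1 := limit_deriv_zero_aux u hu hi atTop (by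
    intro s hs
    obtain ⟨a, ha⟩ := mem_atTop_sets.1 hs
    have : volume (Set.Ici a) ≤ volume s := measure_mono (fun x hx => ha x hx)
    simpa using this) _ (fun ξ h => tendsto_atTop_mono (fun x => (h x).1.le) tendsto_id) t1
  have e2 := limit_deriv_zero_aux u hu hi atBot (by
    intro s hs
    obtain ⟨a, ha⟩ := mem_atBot_sets.1 hs
    have : volume (Set.Iic a) ≤ volume s := measure_mono (fun x hx => ha x hx)
    simpa using this) _ (fun ξ h => tendsto_atBot_mono (fun x => (h x).2.le)
      (tendsto_atBot_add_const_right _ 1 tendsto_id)) t2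
  rw [integral_of_hasDerivAt_of_tendsto hd hi2 t2 t1, e1, e2, sub_zero]

theorem integrable_rhoM2_aux {m : ℕ} (ρ : ℝ × ℝ × (Fin m → ℝ) → ℝ) (hi : Integrable ρ) :
    Integrable (fun p : ℝ × (Fin m → ℝ) => rhoM2 ρ p.1 p.2) := by
  let e : (ℝ × (Fin m → ℝ)) × ℝ ≃ᵐ ℝ × ℝ × (Fin m → ℝ) :=
    MeasurableEquiv.prodAssoc.trans ((MeasurableEquiv.refl ℝ).prodCongr MeasurableEquiv.prodComm)
  have he : MeasurePreserving e volume volume := by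
    have a1 : MeasurePreserving
        (MeasurableEquiv.prodAssoc : (ℝ × (Fin m → ℝ)) × ℝ ≃ᵐ ℝ × (Fin m → ℝ) × ℝ)
        volume volume := measurePreserving_prodAssoc volume volume volume
    have a2 : MeasurePreserving (Prod.map (id : ℝ → ℝ) (Prod.swap : (Fin m → ℝ) × ℝ → _))
        volume volume := (MeasurePreserving.id volume).prod Measure.measurePreserving_swap
    exact a2.comp a1
  have h2 : Integrable (ρ ∘ e) := (he.integrable_comp_emb e.measurableEmbedding).2 hi
  exact Integrable.integral_prod_left h2

/-- when g₁₁ is a constant, the diffusion contribution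
(1/2)∫ ρ_{2|1} ∂²(g₁₁ρ_{∖2})/∂x₁² dx to the information flow vanishes. -/
theorem diffusion_contribution_vanishes
    (m : ℕ) (hm : 1 ≤ m)
    (ρ : ℝ × ℝ × (Fin m → ℝ) → ℝ)
    (hρ_meas : Measurable ρ)
    (hρ_nonneg : ∀ x, 0 ≤ ρ x)
    (hρ_int : Integrable ρ)
    (hρ_prob : ∫ x : ℝ × ℝ × (Fin m → ℝ), ρ x = 1)
    (hρ1_pos : ∀ᵐ x₁ : ℝ, 0 < rho1 ρ x₁)
    -- g₁₁ is a constant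
    (g₁₁ : ℝ)
    -- ρ_{∖2} is twice continuously differentiable in x₁
    (h_smooth : ∀ y : Fin m → ℝ, ContDiff ℝ 2 (fun t => rhoM2 ρ t y))
    -- ∂²ρ_{∖2}/∂x₁² is integrable on ℝ^{d-1}
    (h_int1 : Integrable (fun p : ℝ × (Fin m → ℝ) =>
      deriv (deriv (fun t => rhoM2 ρ t p.2)) p.1))
    -- differentiation under the integral sign:
    -- ∂²ρ₁/∂x₁²(x₁) = ∫_{ℝ^{d-2}} ∂²ρ_{∖2}/∂x₁² dx₃⋯dx_d
    (h_under : ∀ x₁ : ℝ,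
      deriv (deriv (rho1 ρ)) x₁ = ∫ y : Fin m → ℝ, deriv (deriv (fun t => rhoM2 ρ t y)) x₁)
    -- ∂ρ₁/∂x₁ → 0 as x₁ → ±∞
    (h_decay_top : Tendsto (deriv (rho1 ρ)) atTop (nhds 0))
    (h_decay_bot : Tendsto (deriv (rho1 ρ)) atBot (nhds 0))
    -- ρ_{2|1}·∂²ρ_{∖2}/∂x₁² is integrable on ℝ^d
    (h_int2 : Integrable (fun x : ℝ × ℝ × (Fin m → ℝ) =>
      rho2c ρ x.1 x.2.1 * deriv (deriv (fun t => rhoM2 ρ t x.2.2)) x.1)) :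
    (1/2) * ∫ x : ℝ × ℝ × (Fin m → ℝ),
      rho2c ρ x.1 x.2.1 * deriv (deriv (fun t => g₁₁ * rhoM2 ρ t x.2.2)) x.1 = 0 := by
  have hM := integrable_rhoM2_aux ρ hρ_int
  have hz : ∀ᵐ y : Fin m → ℝ, ∫ t, deriv (deriv (fun t => rhoM2 ρ t y)) t = 0 := by
    filter_upwards [hM.prod_left_ae, h_int1.prod_left_ae] with y h1 h2
    exact integral_second_deriv_zero_aux _ (h_smooth y) h1 h2
  have hD : ∫ t : ℝ, ∫ y : Fin m → ℝ, deriv (deriv (fun t => rhoM2 ρ t y)) t = 0 := by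
    rw [integral_integral_swap h_int1]
    rw [integral_congr_ae hz]
    simp
  have hmain : ∫ x : ℝ × ℝ × (Fin m → ℝ),
      rho2c ρ x.1 x.2.1 * deriv (deriv (fun t => rhoM2 ρ t x.2.2)) x.1 = 0 := by
    rw [Measure.volume_eq_prod, integral_prod _ h_int2, ← hD]
    apply integral_congr_ae
    filter_upwards [hρ1_pos, hρ_int.prod_right_ae] with t ht hs
    have h1 : ∫ x₂ : ℝ, rho2c ρ t x₂ = 1 := by
      have : ∫ x₂ : ℝ, rho12 ρ t x₂ = rho1 ρ t := (integral_prod _ hs).symm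
      simp only [rho2c]
      rw [integral_div, this, div_self ht.ne']
    have h2 := integral_prod_mul (μ := (volume : Measure ℝ)) (ν := (volume : Measure (Fin m → ℝ)))
      (fun x₂ => rho2c ρ t x₂) (fun y => deriv (deriv (fun t => rhoM2 ρ t y)) t)
    rw [h1, one_mul] at h2
    exact h2
  have hg : ∀ x : ℝ × ℝ × (Fin m → ℝ),
      rho2c ρ x.1 x.2.1 * deriv (deriv (fun t => g₁₁ * rhoM2 ρ t x.2.2)) x.1 =
      g₁₁ * (rho2c ρ x.1 x.2.1 * deriv (deriv (fun t => rhoM2 ρ t x.2.2)) x.1) := by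
    intro x
    have : deriv (fun t => g₁₁ * rhoM2 ρ t x.2.2) =
        fun s => g₁₁ * deriv (fun t => rhoM2 ρ t x.2.2) s := by
      funext s
      exact deriv_const_mul_field _
    rw [this, deriv_const_mul_field]
    ring
  simp_rw [hg]
  rw [integral_const_mul, hmain]
  simp
end
end

section
/- (Theorem 4, linear–Gaussian case.) Let d ≥ 3, let μ ∈ ℝ^d and let Σ ∈ ℝ^{d×d} be a symmetric positive-definite matrix, and let ρ(x) = (2π)^{−d/2}(det Σ)^{−1/2} exp(−(1/2)(x−μ)ᵀΣ⁻¹(x−μ)) be the corresponding multivariate Gaussian density on ℝ^d. Let F₁(x) = f₁ + Σ_{k=1}^d a_{1k} x_k be an affine function and let g₁₁ be a constant. Then the information flow from the second to the first coordinate equals T_{2→1} = −∫_{ℝ^d} ρ_{2|1}(x₂|x₁) ∂(F₁ρ_{∖2})/∂x₁ dx + (1/2)∫_{ℝ^d} ρ_{2|1}(x₂|x₁) ∂²(g₁₁ρ_{∖2})/∂x₁² dx = a₁₂ · Σ₁₂/Σ₁₁, where Σ₁₂ and Σ₁₁ are the (1,2) and (1,1) entries of Σ. -/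
open MeasureTheory Filter Matrix

noncomputable section

/-- Identify ℝ × ℝ × ℝ^{d-2} with ℝ^d (d = m+2). -/
def toVec {m : ℕ} (x : ℝ × ℝ × (Fin m → ℝ)) : Fin (m + 2) → ℝ :=
  Fin.cons x.1 (Fin.cons x.2.1 x.2.2)

/-- The multivariate Gaussian density on ℝ^d with mean μ and covariance Σ:
ρ(x) = (2π)^{−d/2}(det Σ)^{−1/2} exp(−(1/2)(x−μ)ᵀΣ⁻¹(x−μ)). -/
def gaussDens {m : ℕ} (μ : Fin (m + 2) → ℝ) (S : Matrix (Fin (m + 2)) (Fin (m + 2)) ℝ)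
    (x : ℝ × ℝ × (Fin m → ℝ)) : ℝ :=
  (2 * Real.pi) ^ (-((m + 2 : ℕ) : ℝ) / 2) * S.det ^ (-(1 : ℝ) / 2) *
    Real.exp (-(1 / 2) * ((toVec x - μ) ⬝ᵥ (S⁻¹ *ᵥ (toVec x - μ))))


/-- Rapidly decreasing continuous function. -/
def Rapid {E : Type*} [NormedAddCommGroup E] (f : E → ℝ) : Prop :=
  Continuous f ∧ ∀ k : ℕ, ∃ C : ℝ, ∀ x, |f x| * (1 + ‖x‖) ^ k ≤ C

/-- Continuous function of at most linear growth. -/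
def LinG {E : Type*} [NormedAddCommGroup E] (f : E → ℝ) : Prop :=
  Continuous f ∧ ∃ C : ℝ, ∀ x, |f x| ≤ C * (1 + ‖x‖)

lemma Rapid.add {E : Type*} [NormedAddCommGroup E] {f g : E → ℝ} (hf : Rapid f) (hg : Rapid g) :
    Rapid (fun x => f x + g x) := by
  refine ⟨hf.1.add hg.1, fun k => ?_⟩
  obtain ⟨C, hC⟩ := hf.2 k
  obtain ⟨D, hD⟩ := hg.2 k
  refine ⟨C + D, fun x => ?_⟩
  have h1 := hC x
  have h2 := hD x
  have h3 : |f x + g x| * (1 + ‖x‖) ^ k ≤ (|f x| + |g x|) * (1 + ‖x‖) ^ k := by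
    gcongr
    exact abs_add_le _ _
  linarith

lemma Rapid.mul {E : Type*} [NormedAddCommGroup E] {f g : E → ℝ} (hf : LinG f) (hg : Rapid g) :
    Rapid (fun x => f x * g x) := by
  refine ⟨hf.1.mul hg.1, fun k => ?_⟩
  obtain ⟨C, hC⟩ := hf.2
  obtain ⟨D, hD⟩ := hg.2 (k + 1)
  have hC0 : 0 ≤ C := by
    have h0 := hC 0
    simp only [norm_zero, add_zero, mul_one] at h0
    exact (abs_nonneg _).trans h0
  refine ⟨C * D, fun x => ?_⟩
  calc |f x * g x| * (1 + ‖x‖) ^ k = |f x| * (|g x| * (1 + ‖x‖) ^ k) := by rw [abs_mul]; ring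
    _ ≤ (C * (1 + ‖x‖)) * (|g x| * (1 + ‖x‖) ^ k) := by gcongr; exact hC x
    _ = C * (|g x| * (1 + ‖x‖) ^ (k + 1)) := by ring
    _ ≤ C * D := by gcongr; exact hD x

lemma LinG.add {E : Type*} [NormedAddCommGroup E] {f g : E → ℝ} (hf : LinG f) (hg : LinG g) :
    LinG (fun x => f x + g x) := by
  obtain ⟨C, hC⟩ := hf.2
  obtain ⟨D, hD⟩ := hg.2
  refine ⟨hf.1.add hg.1, C + D, fun x => ?_⟩
  have := abs_add_le (f x) (g x)
  have := hC x
  have := hD x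
  linarith

lemma LinG.const {E : Type*} [NormedAddCommGroup E] (c : ℝ) : LinG (fun _ : E => c) :=
  ⟨continuous_const, |c|, fun x => by
    have := norm_nonneg x
    have := abs_nonneg c
    nlinarith⟩

lemma LinG.cmul {E : Type*} [NormedAddCommGroup E] {f : E → ℝ} (c : ℝ) (hf : LinG f) :
    LinG (fun x => c * f x) := by
  obtain ⟨C, hC⟩ := hf.2
  refine ⟨continuous_const.mul hf.1, |c| * C, fun x => ?_⟩
  rw [abs_mul, mul_assoc]
  gcongr
  exact hC x

lemma LinG.of_clm {E : Type*} [NormedAddCommGroup E] [NormedSpace ℝ E] (L : E →L[ℝ] ℝ) :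
    LinG (fun x => L x) := by
  refine ⟨L.continuous, ‖L‖, fun x => ?_⟩
  have := L.le_opNorm x
  rw [Real.norm_eq_abs] at this
  have := norm_nonneg L
  nlinarith

lemma LinG.of_lin {E : Type*} [NormedAddCommGroup E] [NormedSpace ℝ E] [FiniteDimensional ℝ E]
    (f : E → ℝ) (h1 : ∀ x y, f (x + y) = f x + f y) (h2 : ∀ (c : ℝ) x, f (c • x) = c * f x) :
    LinG f :=
  LinG.of_clm (LinearMap.toContinuousLinearMap
    ({ toFun := f, map_add' := h1, map_smul' := h2 } : E →ₗ[ℝ] ℝ))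

lemma Rapid.integrable {E : Type*} [NormedAddCommGroup E] [NormedSpace ℝ E]
    [FiniteDimensional ℝ E] [MeasurableSpace E] [BorelSpace E] {ν : Measure E}
    [ν.IsAddHaarMeasure] {f : E → ℝ} (hf : Rapid f) : Integrable f ν := by
  obtain ⟨C, hC⟩ := hf.2 (Module.finrank ℝ E + 1)
  have h := integrable_one_add_norm (E := E) (μ := ν) (r := (Module.finrank ℝ E + 1 : ℕ))
    (by push_cast; linarith)
  refine (h.const_mul C).mono' hf.1.aestronglyMeasurable (Eventually.of_forall fun x => ?_)
  have hp : 0 < 1 + ‖x‖ := by positivity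
  rw [Real.norm_eq_abs, Real.rpow_neg hp.le, Real.rpow_natCast, ← div_eq_mul_inv,
    le_div_iff₀ (by positivity)]
  exact hC x

lemma Rapid.comp {E F : Type*} [NormedAddCommGroup E] [NormedAddCommGroup F] {f : E → ℝ}
    (hf : Rapid f) {φ : F → E} (hφ : Continuous φ) (hn : ∀ x, ‖x‖ ≤ ‖φ x‖) :
    Rapid (fun x => f (φ x)) := by
  refine ⟨hf.1.comp hφ, fun k => ?_⟩
  obtain ⟨C, hC⟩ := hf.2 k
  refine ⟨C, fun x => le_trans ?_ (hC (φ x))⟩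
  gcongr
  exact hn x

lemma rapid_exp {E : Type*} [NormedAddCommGroup E] [NormedSpace ℝ E] [FiniteDimensional ℝ E]
    (q : E → ℝ) (hc : Continuous q) (hh : ∀ (c : ℝ) x, q (c • x) = c ^ 2 * q x)
    (hpos : ∀ x, x ≠ 0 → 0 < q x) (x₀ : E) :
    Rapid (fun x => Real.exp (-(1 / 2) * q (x - x₀))) := by
  have hq0 : q 0 = 0 := by simpa using hh 0 0
  obtain ⟨ε, hε, hb⟩ : ∃ ε > 0, ∀ x, ε * ‖x‖ ^ 2 ≤ q x := by
    by_cases hne : (Metric.sphere (0 : E) 1).Nonempty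
    · obtain ⟨z, hz, hmin⟩ := (isCompact_sphere (0 : E) 1).exists_isMinOn hne hc.continuousOn
      have hz0 : z ≠ 0 := by
        rintro rfl
        simp at hz
      refine ⟨q z, hpos z hz0, fun x => ?_⟩
      by_cases hx : x = 0
      · simp [hx, hq0]
      have hx' : ‖x‖ ≠ 0 := norm_ne_zero_iff.mpr hx
      have h1 : q z ≤ q (‖x‖⁻¹ • x) := hmin (by simp [norm_smul, hx'])
      rw [hh] at h1
      have h2 : 0 < ‖x‖ ^ 2 := by positivity
      calc q z * ‖x‖ ^ 2 ≤ (‖x‖⁻¹ ^ 2 * q x) * ‖x‖ ^ 2 := by gcongr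
        _ = q x := by field_simp
    · refine ⟨1, one_pos, fun x => ?_⟩
      by_cases hx : x = 0
      · simp [hx, hq0]
      exact absurd ⟨‖x‖⁻¹ • x, by simp [norm_smul, hx]⟩ hne
  refine ⟨by fun_prop, fun k => ⟨(1 + ‖x₀‖) ^ k * (k.factorial * Real.exp (1 + 1 / (2 * ε))),
    fun x => ?_⟩⟩
  set r := ‖x - x₀‖ with hr
  have hr0 : 0 ≤ r := norm_nonneg _
  have h1 : 1 + ‖x‖ ≤ (1 + ‖x₀‖) * (1 + r) := by
    have : ‖x‖ ≤ r + ‖x₀‖ := by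
      have := norm_add_le (x - x₀) x₀
      simpa using this
    nlinarith [norm_nonneg x₀]
  have h2 : (1 + r) ^ k ≤ k.factorial * Real.exp (1 + r) := by
    have := Real.pow_div_factorial_le_exp (1 + r) (by positivity) k
    rwa [div_le_iff₀ (by positivity), mul_comm] at this
  have h3 : Real.exp (-(1 / 2) * q (x - x₀)) * Real.exp (1 + r) ≤ Real.exp (1 + 1 / (2 * ε)) := by
    rw [← Real.exp_add]
    apply Real.exp_le_exp.mpr
    have := hb (x - x₀)
    rw [← hr] at this
    have h4 : r - ε * r ^ 2 / 2 ≤ 1 / (2 * ε) := by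
      rw [le_div_iff₀ (by positivity)]
      nlinarith [sq_nonneg (ε * r - 1)]
    linarith
  rw [abs_of_pos (Real.exp_pos _)]
  calc Real.exp (-(1 / 2) * q (x - x₀)) * (1 + ‖x‖) ^ k
      ≤ Real.exp (-(1 / 2) * q (x - x₀)) * ((1 + ‖x₀‖) * (1 + r)) ^ k := by gcongr
    _ = (1 + ‖x₀‖) ^ k * (Real.exp (-(1 / 2) * q (x - x₀)) * (1 + r) ^ k) := by
        rw [mul_pow]; ring
    _ ≤ (1 + ‖x₀‖) ^ k * (Real.exp (-(1 / 2) * q (x - x₀)) * (k.factorial * Real.exp (1 + r))) := by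
        gcongr
    _ = (1 + ‖x₀‖) ^ k * (k.factorial * (Real.exp (-(1 / 2) * q (x - x₀)) * Real.exp (1 + r))) := by
        ring
    _ ≤ _ := by gcongr

instance haar2 (m : ℕ) : (volume : Measure (ℝ × (Fin m → ℝ))).IsAddHaarMeasure :=
  Measure.prod.instIsAddHaarMeasure _ _

instance haar3 (m : ℕ) : (volume : Measure (ℝ × ℝ × (Fin m → ℝ))).IsAddHaarMeasure :=
  Measure.prod.instIsAddHaarMeasure _ _


open scoped MatrixOrder in
lemma gauss_full {n : ℕ} (S : Matrix (Fin n) (Fin n) ℝ) (hS : S.PosDef) :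
    ∫ x : Fin n → ℝ, Real.exp (-(1 / 2) * (x ⬝ᵥ (S⁻¹ *ᵥ x))) =
      (2 * Real.pi) ^ ((n : ℝ) / 2) * S.det ^ ((1 : ℝ) / 2) := by
  have hP := hS.inv
  obtain ⟨B, hB⟩ := CStarAlgebra.nonneg_iff_eq_star_mul_self.mp hP.posSemidef.nonneg
  have hdet : S.det⁻¹ = B.det ^ 2 := by
    have := congrArg Matrix.det hB
    rw [Matrix.det_nonsing_inv, Ring.inverse_eq_inv', Matrix.det_mul, Matrix.star_eq_conjTranspose,
      Matrix.det_conjTranspose] at this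
    simp at this
    rw [this]; ring
  have hSd := hS.det_pos
  have hBd : B.det ≠ 0 := by
    intro h
    rw [h] at hdet
    have := inv_pos.mpr hSd
    simp at hdet
    linarith
  have hq : ∀ x : Fin n → ℝ, x ⬝ᵥ (S⁻¹ *ᵥ x) = (B *ᵥ x) ⬝ᵥ (B *ᵥ x) := by
    intro x
    rw [hB, Matrix.star_eq_conjTranspose, ← Matrix.mulVec_mulVec, Matrix.dotProduct_mulVec,
      Matrix.conjTranspose_eq_transpose_of_trivial, Matrix.vecMul_transpose]
  have hstd : ∫ z : Fin n → ℝ, Real.exp (-(1 / 2) * (z ⬝ᵥ z)) = (2 * Real.pi) ^ ((n : ℝ) / 2) := by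
    have h1 : ∀ z : Fin n → ℝ, Real.exp (-(1 / 2) * (z ⬝ᵥ z)) =
        ∏ i, Real.exp (-(1 / 2) * z i ^ 2) := by
      intro z
      rw [← Real.exp_sum, dotProduct, Finset.mul_sum]
      simp only [pow_two]
    simp_rw [h1]
    rw [integral_fintype_prod_volume_eq_pow (fun t : ℝ => Real.exp (-(1 / 2) * t ^ 2)),
      integral_gaussian, Fintype.card_fin, Real.sqrt_eq_rpow, ← Real.rpow_natCast,
      ← Real.rpow_mul (by positivity)]
    congr 1
    · ring
    · ring
  simp_rw [hq]
  have hmap := Real.map_matrix_volume_pi_eq_smul_volume_pi hBd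
  have h2 : ∫ x : Fin n → ℝ, Real.exp (-(1 / 2) * ((B *ᵥ x) ⬝ᵥ (B *ᵥ x))) =
      ∫ z, Real.exp (-(1 / 2) * (z ⬝ᵥ z)) ∂(Measure.map (⇑(Matrix.toLin' B)) volume) := by
    rw [integral_map]
    · simp [Matrix.toLin'_apply]
    · exact (LinearMap.continuous_of_finiteDimensional _).aemeasurable
    · refine Continuous.aestronglyMeasurable ?_
      unfold dotProduct
      fun_prop
  rw [h2, hmap, integral_smul_measure, hstd, ENNReal.toReal_ofReal (abs_nonneg _), smul_eq_mul,
    mul_comm]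
  congr 1
  rw [← Real.sqrt_eq_rpow, ← Real.sqrt_sq_eq_abs, inv_pow, ← hdet, inv_inv]

lemma toVec_integral {m : ℕ} (f : (Fin (m + 2) → ℝ) → ℝ) :
    ∫ x : ℝ × ℝ × (Fin m → ℝ), f (toVec x) = ∫ z, f z := by
  have h1 := (volume_preserving_piFinSuccAbove (fun _ : Fin (m + 2) => ℝ) 0).symm
  have h2 := (volume_preserving_piFinSuccAbove (fun _ : Fin (m + 1) => ℝ) 0).symm
  have h3 := (MeasurePreserving.id (volume : Measure ℝ)).prod h2
  rw [← h1.integral_comp (MeasurableEquiv.measurableEmbedding _) f]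
  refine Eq.trans ?_ (h3.integral_comp ((MeasurableEquiv.prodCongr (MeasurableEquiv.refl ℝ)
    (MeasurableEquiv.piFinSuccAbove (fun _ : Fin (m + 1) => ℝ) 0).symm).measurableEmbedding) _)
  refine integral_congr_ae (Eventually.of_forall fun x => ?_)
  simp only
  congr 1
  simp [toVec, MeasurableEquiv.piFinSuccAbove, Fin.insertNthEquiv]


lemma gauss_mean_affine (μ : ℝ) {s : NNReal} (hs : s ≠ 0) (p q : ℝ) :
    ∫ v, ProbabilityTheory.gaussianPDFReal μ s v * (p + v * q) = p + μ * q := by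
  have h := ProbabilityTheory.integral_gaussianReal_eq_integral_smul (μ := μ) (v := s)
    (f := fun v => p + v * q) hs
  simp only [smul_eq_mul] at h
  rw [← h]
  have hi : Integrable (fun v : ℝ => v) (ProbabilityTheory.gaussianReal μ s) :=
    (ProbabilityTheory.memLp_id_gaussianReal (μ := μ) (v := s) 1).integrable (by norm_num)
  rw [integral_add (integrable_const _) (hi.mul_const q), integral_mul_const,
    ProbabilityTheory.integral_id_gaussianReal]
  simp

lemma int_cond {m : ℕ} (c : ℝ → ℝ → ℝ) (mean : ℝ → ℝ) {s : NNReal} (hs : s ≠ 0)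
    (hc : ∀ t v, c t v = ProbabilityTheory.gaussianPDFReal (mean t) s v)
    (hmean : LinG (fun z : ℝ × (Fin m → ℝ) => mean z.1))
    (h0 h1 : ℝ → (Fin m → ℝ) → ℝ)
    (hr : Rapid (fun x : ℝ × ℝ × (Fin m → ℝ) => c x.1 x.2.1 * (h0 x.1 x.2.2 + x.2.1 * h1 x.1 x.2.2)))
    (hr0 : Rapid (fun z : ℝ × (Fin m → ℝ) => h0 z.1 z.2))
    (hr1 : Rapid (fun z : ℝ × (Fin m → ℝ) => h1 z.1 z.2)) :
    ∫ x : ℝ × ℝ × (Fin m → ℝ), c x.1 x.2.1 * (h0 x.1 x.2.2 + x.2.1 * h1 x.1 x.2.2) =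
      ∫ y, ∫ t, (h0 t y + mean t * h1 t y) := by
  have hi := hr.integrable (ν := volume)
  rw [Measure.volume_eq_prod] at hi ⊢
  rw [integral_prod _ hi]
  have hrr : Rapid (fun z : ℝ × (Fin m → ℝ) => h0 z.1 z.2 + mean z.1 * h1 z.1 z.2) :=
    hr0.add (Rapid.mul hmean hr1)
  have hii := hrr.integrable (ν := volume)
  rw [Measure.volume_eq_prod] at hii
  rw [← integral_integral_swap (f := fun t y => h0 t y + mean t * h1 t y) hii]
  refine integral_congr_ae (Eventually.of_forall fun t => ?_)
  have hs2 : Rapid (fun p : ℝ × (Fin m → ℝ) => c t p.1 * (h0 t p.2 + p.1 * h1 t p.2)) :=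
    hr.comp (φ := fun p => (t, p)) (by fun_prop) (fun p => by
      simp [Prod.norm_def])
  have hi2 := hs2.integrable (ν := volume)
  simp only
  rw [Measure.volume_eq_prod] at hi2 ⊢
  rw [integral_prod_symm _ hi2]
  refine integral_congr_ae (Eventually.of_forall fun y => ?_)
  simp only [hc]
  exact gauss_mean_affine _ hs _ _

lemma flow_core {m : ℕ} (α β K μ0 μ1 f a0 a1 : ℝ) {s : NNReal} (hs : s ≠ 0)
    (L M A : (Fin m → ℝ) → ℝ) (μw : Fin m → ℝ)
    (hL1 : ∀ x y, L (x + y) = L x + L y) (hL2 : ∀ (c : ℝ) x, L (c • x) = c * L x)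
    (hA1 : ∀ x y, A (x + y) = A x + A y) (hA2 : ∀ (c : ℝ) x, A (c • x) = c * A x)
    (hM : Continuous M) (hM2 : ∀ (c : ℝ) x, M (c • x) = c ^ 2 * M x)
    (hpos : ∀ u w, (u, w) ≠ (0 : ℝ × (Fin m → ℝ)) → 0 < α * u ^ 2 + 2 * u * L w + M w)
    (R : ℝ → (Fin m → ℝ) → ℝ) (c : ℝ → ℝ → ℝ) (hR : ∀ t y, R t y =
      K * Real.exp (-(1 / 2) * (α * (t - μ0) ^ 2 + 2 * (t - μ0) * L (y - μw) + M (y - μw))))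
    (hc : ∀ t v, c t v = ProbabilityTheory.gaussianPDFReal (μ1 + β * (t - μ0)) s v)
    (hone' : Integrable (fun z : ℝ × (Fin m → ℝ) => R z.1 z.2) →
      ∫ z : ℝ × (Fin m → ℝ), R z.1 z.2 = 1) :
    (∫ x : ℝ × ℝ × (Fin m → ℝ), c x.1 x.2.1 *
        deriv (fun t => (f + (a0 * t + (a1 * x.2.1 + A x.2.2))) * R t x.2.2) x.1 = - (a1 * β)) ∧
    (∀ g : ℝ, ∫ x : ℝ × ℝ × (Fin m → ℝ), c x.1 x.2.1 *
        deriv (deriv (fun t => g * R t x.2.2)) x.1 = 0) := by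
  have hLc : Continuous L := (LinG.of_lin L hL1 hL2).1
  have hAc : Continuous A := (LinG.of_lin A hA1 hA2).1
  -- gradient
  set G : ℝ → (Fin m → ℝ) → ℝ := fun t y => -(α * (t - μ0) + L (y - μw)) with hG
  have hd : ∀ t y, HasDerivAt (fun t => R t y) (G t y * R t y) t := by
    intro t y
    have e : (fun t => R t y) = fun t => K * Real.exp (-(1 / 2) * (α * (t - μ0) ^ 2 + 2 * (t - μ0) * L (y - μw) + M (y - μw))) := by
      funext t; exact hR t y
    rw [e, hR]
    have h1 : HasDerivAt (fun t : ℝ => t - μ0) 1 t := (hasDerivAt_id t).sub_const μ0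
    have h2 := (((((h1.pow 2).const_mul α).add ((h1.const_mul 2).mul_const (L (y - μw)))).add_const
      (M (y - μw))).const_mul (-(1 / 2))).exp.const_mul K
    refine HasDerivAt.congr_deriv h2 ?_
    simp only [hG, Pi.add_apply, Pi.pow_apply]
    push_cast
    ring
  have hdG : ∀ t y, HasDerivAt (fun t => G t y) (-α) t := by
    intro t y
    have h1 : HasDerivAt (fun t : ℝ => t - μ0) 1 t := (hasDerivAt_id t).sub_const μ0
    have h2 := ((h1.const_mul α).add_const (L (y - μw))).neg
    exact HasDerivAt.congr_deriv h2 (by ring)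
  -- rapid decrease
  have hRr : Rapid (fun z : ℝ × (Fin m → ℝ) => R z.1 z.2) := by
    have h := rapid_exp (fun z : ℝ × (Fin m → ℝ) => α * z.1 ^ 2 + 2 * z.1 * L z.2 + M z.2)
      (by fun_prop) (fun c z => by simp only [Prod.smul_fst, Prod.smul_snd, smul_eq_mul, hL2, hM2]; ring)
      (fun z hz => hpos z.1 z.2 hz) (μ0, μw)
    have h2 := Rapid.mul (LinG.const K) h
    convert h2 using 2 with z
    exact hR _ _
  have hcR : Rapid (fun x : ℝ × ℝ × (Fin m → ℝ) => c x.1 x.2.1 * R x.1 x.2.2) := by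
    have hsp : (0 : ℝ) < s := by positivity
    have h := rapid_exp (fun x : ℝ × ℝ × (Fin m → ℝ) => (x.2.1 - β * x.1) ^ 2 / s +
        (α * x.1 ^ 2 + 2 * x.1 * L x.2.2 + M x.2.2))
      (by fun_prop) (fun c z => by
        simp only [Prod.smul_fst, Prod.smul_snd, smul_eq_mul, hL2, hM2]; ring)
      (fun x hx => by
        by_cases hz : (x.1, x.2.2) = (0 : ℝ × (Fin m → ℝ))
        · have h1 : x.1 = 0 := congrArg Prod.fst hz
          have h2 : x.2.2 = 0 := congrArg Prod.snd hz
          have h3 : x.2.1 ≠ 0 := by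
            intro h3
            exact hx (Prod.ext h1 (Prod.ext h3 h2))
          have hL0 : L 0 = 0 := by simpa using hL2 0 0
          have hM0 : M 0 = 0 := by simpa using hM2 0 0
          rw [h1, h2, hL0, hM0]
          simp only [mul_zero, sub_zero, add_zero, ne_eq, OfNat.ofNat_ne_zero, not_false_eq_true, zero_pow]
          positivity
        · have := hpos _ _ hz
          positivity) (μ0, μ1, μw)
    have h2 := Rapid.mul (LinG.const ((√(2 * Real.pi * s))⁻¹ * K)) h
    convert h2 using 2 with x
    rw [hR, hc, ProbabilityTheory.gaussianPDFReal]
    simp only [Prod.fst_sub, Prod.snd_sub]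
    rw [mul_add (-(1 / 2 : ℝ)) (_ / _), Real.exp_add]
    have : -(x.2.1 - (μ1 + β * (x.1 - μ0))) ^ 2 / (2 * (s : ℝ)) =
        -(1 / 2) * ((x.2.1 - μ1 - β * (x.1 - μ0)) ^ 2 / s) := by
      field_simp
      ring
    rw [this]
    ring
  -- growth
  have hone := hone' hRr.integrable
  have hone2 : ∫ y, ∫ t, R t y = 1 := by
    rw [← hone, Measure.volume_eq_prod, integral_prod_symm]
    have := hRr.integrable (ν := volume)
    rwa [Measure.volume_eq_prod] at this
  have gt2 : LinG (fun z : ℝ × (Fin m → ℝ) => z.1) := LinG.of_lin _ (by simp) (by simp)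
  have gt3 : LinG (fun x : ℝ × ℝ × (Fin m → ℝ) => x.1) := LinG.of_lin _ (by simp) (by simp)
  have gv3 : LinG (fun x : ℝ × ℝ × (Fin m → ℝ) => x.2.1) := LinG.of_lin _ (by simp) (by simp)
  have gA2 : LinG (fun z : ℝ × (Fin m → ℝ) => A z.2) :=
    LinG.of_lin _ (by simp [hA1]) (by simp [hA2])
  have gA3 : LinG (fun x : ℝ × ℝ × (Fin m → ℝ) => A x.2.2) :=
    LinG.of_lin _ (by simp [hA1]) (by simp [hA2])
  have gL2 : LinG (fun z : ℝ × (Fin m → ℝ) => L z.2) :=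
    LinG.of_lin _ (by simp [hL1]) (by simp [hL2])
  have gL3 : LinG (fun x : ℝ × ℝ × (Fin m → ℝ) => L x.2.2) :=
    LinG.of_lin _ (by simp [hL1]) (by simp [hL2])
  have hLs : ∀ y, L (y - μw) = L y + -L μw := by
    intro y
    have := hL1 (y - μw) μw
    rw [sub_add_cancel] at this
    linarith
  have hGe : ∀ t y, G t y = (-α) * t + ((-1) * L y + (α * μ0 + L μw)) := by
    intro t y
    simp only [hG, hLs]
    ring
  have gG2 : LinG (fun z : ℝ × (Fin m → ℝ) => G z.1 z.2) := by
    simp only [hGe]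
    exact (gt2.cmul _).add ((gL2.cmul _).add (LinG.const _))
  have gG3 : LinG (fun x : ℝ × ℝ × (Fin m → ℝ) => G x.1 x.2.2) := by
    simp only [hGe]
    exact (gt3.cmul _).add ((gL3.cmul _).add (LinG.const _))
  have gm2 : LinG (fun z : ℝ × (Fin m → ℝ) => μ1 + β * (z.1 - μ0)) := by
    have : (fun z : ℝ × (Fin m → ℝ) => μ1 + β * (z.1 - μ0)) = fun z => β * z.1 + (μ1 - β * μ0) := by
      funext z; ring
    rw [this]
    exact (gt2.cmul _).add (LinG.const _)
  have gF2 : LinG (fun z : ℝ × (Fin m → ℝ) => f + (a0 * z.1 + A z.2)) :=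
    (LinG.const _).add ((gt2.cmul _).add gA2)
  have gF3 : LinG (fun x : ℝ × ℝ × (Fin m → ℝ) => f + (a0 * x.1 + (a1 * x.2.1 + A x.2.2))) :=
    (LinG.const _).add ((gt3.cmul _).add ((gv3.cmul _).add gA3))
  have sec : ∀ {h : ℝ × (Fin m → ℝ) → ℝ}, Rapid h → ∀ y, Integrable (fun t => h (t, y)) := by
    intro h hh y
    exact (hh.comp (φ := fun t : ℝ => (t, y)) (by fun_prop) (fun t => by
      simp [Prod.norm_def])).integrable
  constructor
  · have e : ∀ x : ℝ × ℝ × (Fin m → ℝ), c x.1 x.2.1 *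
        deriv (fun t => (f + (a0 * t + (a1 * x.2.1 + A x.2.2))) * R t x.2.2) x.1 =
        c x.1 x.2.1 * ((a0 * R x.1 x.2.2 + (f + (a0 * x.1 + A x.2.2)) * (G x.1 x.2.2 * R x.1 x.2.2))
          + x.2.1 * (a1 * (G x.1 x.2.2 * R x.1 x.2.2))) := by
      intro x
      have h1 := ((((hasDerivAt_id x.1).const_mul a0).add_const (a1 * x.2.1 + A x.2.2)).const_add f).mul
        (hd x.1 x.2.2)
      have h2 := h1.deriv
      simp only [id] at h2
      rw [show (fun t => (f + (a0 * t + (a1 * x.2.1 + A x.2.2))) * R t x.2.2) =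
        ((fun t => (f + (a0 * t + (a1 * x.2.1 + A x.2.2)))) * fun t => R t x.2.2) from rfl, h2]
      ring
    simp_rw [e]
    rw [int_cond c (fun t => μ1 + β * (t - μ0)) hs hc gm2
      (fun t y => a0 * R t y + (f + (a0 * t + A y)) * (G t y * R t y))
      (fun t y => a1 * (G t y * R t y))]
    · have key : ∀ y, ∫ t, (a0 * R t y + (f + (a0 * t + A y)) * (G t y * R t y) +
          (μ1 + β * (t - μ0)) * (a1 * (G t y * R t y))) = -(a1 * β) * ∫ t, R t y := by
        intro y
        have hz := integral_eq_zero_of_hasDerivAt_of_integrable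
          (f := fun t => (f + (a0 * t + A y) + a1 * (μ1 + β * (t - μ0))) * R t y)
          (f' := fun t => (a0 + a1 * β) * R t y +
            (f + (a0 * t + A y) + a1 * (μ1 + β * (t - μ0))) * (G t y * R t y))
          (fun t => by
            have h1 : HasDerivAt (fun t : ℝ => f + (a0 * t + A y) + a1 * (μ1 + β * (t - μ0)))
                (a0 + a1 * β) t := by
              have h2 := ((((hasDerivAt_id t).const_mul a0).add_const (A y)).const_add f).add
                (((((hasDerivAt_id t).sub_const μ0).const_mul β).const_add μ1).const_mul a1)
              exact HasDerivAt.congr_deriv h2 (by ring)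
            exact h1.mul (hd t y))
          (sec ((Rapid.mul (LinG.const (a0 + a1 * β)) hRr).add
            (Rapid.mul (gF2.add (gm2.cmul a1)) (Rapid.mul gG2 hRr))) y)
          (sec (Rapid.mul (gF2.add (gm2.cmul a1)) hRr) y)
        have hi1 := (sec ((Rapid.mul (LinG.const (a0 + a1 * β)) hRr).add
            (Rapid.mul (gF2.add (gm2.cmul a1)) (Rapid.mul gG2 hRr))) y)
        have hi2 := (sec hRr y).const_mul (-(a1 * β))
        have := integral_add hi1 hi2
        simp only at this hz
        rw [hz, integral_const_mul, zero_add] at this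
        rw [← this]
        congr 1
        funext t
        ring
      simp_rw [key]
      rw [integral_const_mul, hone2, mul_one]
    · have := ((Rapid.mul (LinG.const a0) hcR).add (Rapid.mul gF3 (Rapid.mul gG3 hcR)))
      convert this using 2 with x
      ring
    · exact (Rapid.mul (LinG.const a0) hRr).add (Rapid.mul gF2 (Rapid.mul gG2 hRr))
    · exact Rapid.mul (LinG.const a1) (Rapid.mul gG2 hRr)
  · intro g
    have e1 : ∀ y, deriv (fun t => g * R t y) = fun t => g * (G t y * R t y) := by
      intro y
      funext t
      exact ((hd t y).const_mul g).deriv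
    have hd2 : ∀ t y, HasDerivAt (fun t => g * (G t y * R t y))
        (g * ((-α) * R t y + G t y * (G t y * R t y))) t := fun t y =>
      ((hdG t y).mul (hd t y)).const_mul g
    have e : ∀ x : ℝ × ℝ × (Fin m → ℝ), c x.1 x.2.1 *
        deriv (deriv (fun t => g * R t x.2.2)) x.1 =
        c x.1 x.2.1 * ((g * ((-α) * R x.1 x.2.2 + G x.1 x.2.2 * (G x.1 x.2.2 * R x.1 x.2.2)))
          + x.2.1 * 0) := by
      intro x
      rw [e1, (hd2 _ _).deriv, mul_zero, add_zero]
    have hr0 : Rapid (fun z : ℝ × (Fin m → ℝ) =>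
        g * ((-α) * R z.1 z.2 + G z.1 z.2 * (G z.1 z.2 * R z.1 z.2))) :=
      Rapid.mul (LinG.const g) ((Rapid.mul (LinG.const (-α)) hRr).add
        (Rapid.mul gG2 (Rapid.mul gG2 hRr)))
    simp_rw [e]
    rw [int_cond c (fun t => μ1 + β * (t - μ0)) hs hc gm2
      (fun t y => g * ((-α) * R t y + G t y * (G t y * R t y)))
      (fun t y => 0)]
    · have key : ∀ y, ∫ t, (g * ((-α) * R t y + G t y * (G t y * R t y)) +
          (μ1 + β * (t - μ0)) * 0) = 0 := by
        intro y
        simp only [mul_zero, add_zero]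
        exact integral_eq_zero_of_hasDerivAt_of_integrable (fun t => hd2 t y) (sec hr0 y)
          (sec (Rapid.mul (LinG.const g) (Rapid.mul gG2 hRr)) y)
      simp_rw [key]
      simp
    · have := Rapid.mul (LinG.const g) ((Rapid.mul (LinG.const (-α)) hcR).add
        (Rapid.mul gG3 (Rapid.mul gG3 hcR)))
      convert this using 2 with x
      ring
    · exact hr0
    · simpa using Rapid.mul (LinG.const 0) hRr


/-- Quadratic form on the product space. -/
def QF {m : ℕ} (P : Matrix (Fin (m + 2)) (Fin (m + 2)) ℝ) (x : ℝ × ℝ × (Fin m → ℝ)) : ℝ :=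
  toVec x ⬝ᵥ (P *ᵥ toVec x)

/-- Cross terms. -/
def cr {m : ℕ} (P : Matrix (Fin (m + 2)) (Fin (m + 2)) ℝ) (i : Fin (m + 2)) (w : Fin m → ℝ) : ℝ :=
  ∑ j : Fin m, P i j.succ.succ * w j

lemma cr_add {m : ℕ} (P : Matrix (Fin (m + 2)) (Fin (m + 2)) ℝ) (i : Fin (m + 2))
    (x y : Fin m → ℝ) : cr P i (x + y) = cr P i x + cr P i y := by
  simp [cr, mul_add, Finset.sum_add_distrib]

lemma cr_smul {m : ℕ} (P : Matrix (Fin (m + 2)) (Fin (m + 2)) ℝ) (i : Fin (m + 2))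
    (c : ℝ) (x : Fin m → ℝ) : cr P i (c • x) = c * cr P i x := by
  simp only [cr, Pi.smul_apply, smul_eq_mul, Finset.mul_sum]
  exact Finset.sum_congr rfl fun j _ => by ring

lemma toVec_add {m : ℕ} (x y : ℝ × ℝ × (Fin m → ℝ)) : toVec (x + y) = toVec x + toVec y := by
  funext i
  refine Fin.cases ?_ (fun i => Fin.cases ?_ (fun i => ?_) i) i <;> simp [toVec]

lemma toVec_smul {m : ℕ} (c : ℝ) (x : ℝ × ℝ × (Fin m → ℝ)) : toVec (c • x) = c • toVec x := by
  funext i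
  refine Fin.cases ?_ (fun i => Fin.cases ?_ (fun i => ?_) i) i <;> simp [toVec]

lemma toVec_sub_mu {m : ℕ} (μ : Fin (m + 2) → ℝ) (x : ℝ × ℝ × (Fin m → ℝ)) :
    toVec x - μ = toVec (x - (μ 0, μ 1, fun i => μ i.succ.succ)) := by
  funext i
  refine Fin.cases ?_ (fun i => Fin.cases ?_ (fun i => ?_) i) i <;> simp [toVec]

lemma toVec_eta {m : ℕ} (z : Fin (m + 2) → ℝ) :
    z = toVec (z 0, z 1, fun i => z i.succ.succ) := by
  funext i
  refine Fin.cases ?_ (fun i => Fin.cases ?_ (fun i => ?_) i) i <;> simp [toVec]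

lemma toVec_cont {m : ℕ} : Continuous (toVec (m := m)) := by
  refine continuous_pi fun i => ?_
  refine Fin.cases ?_ (fun i => Fin.cases ?_ (fun i => ?_) i) i <;> simp only [toVec, Fin.cons_zero, Fin.cons_succ] <;> fun_prop

lemma toVec_ne {m : ℕ} {x : ℝ × ℝ × (Fin m → ℝ)} (hx : x ≠ 0) : toVec x ≠ 0 := by
  intro h
  apply hx
  refine Prod.ext ?_ (Prod.ext ?_ ?_)
  · simpa [toVec] using congrFun h 0
  · simpa [toVec] using congrFun h 1
  · funext i
    simpa [toVec] using congrFun h i.succ.succ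

lemma QF_cont {m : ℕ} (P : Matrix (Fin (m + 2)) (Fin (m + 2)) ℝ) : Continuous (QF P) := by
  unfold QF dotProduct Matrix.mulVec dotProduct
  have := toVec_cont (m := m)
  fun_prop

lemma QF_smul {m : ℕ} (P : Matrix (Fin (m + 2)) (Fin (m + 2)) ℝ) (c : ℝ) (x) :
    QF P (c • x) = c ^ 2 * QF P x := by
  simp only [QF, toVec_smul, Matrix.mulVec_smul, dotProduct_smul, smul_dotProduct, smul_eq_mul]
  ring

lemma QF_pos {m : ℕ} {P : Matrix (Fin (m + 2)) (Fin (m + 2)) ℝ} (hP : P.PosDef) (x)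
    (hx : x ≠ 0) : 0 < QF P x := by
  simpa [QF] using hP.dotProduct_mulVec_pos (toVec_ne hx)

lemma pd_symm {n : ℕ} {P : Matrix (Fin n) (Fin n) ℝ} (hP : P.PosDef) (i j) : P i j = P j i := by
  simpa using (hP.isHermitian.apply j i)

lemma QF_expand {m : ℕ} {P : Matrix (Fin (m + 2)) (Fin (m + 2)) ℝ} (hP : P.PosDef)
    (u v : ℝ) (w : Fin m → ℝ) :
    QF P (u, v, w) = P 0 0 * u ^ 2 + 2 * P 0 1 * u * v + P 1 1 * v ^ 2 + 2 * u * cr P 0 w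
      + 2 * v * cr P 1 w + QF P (0, 0, w) := by
  have h10 := pd_symm hP 1 0
  have hc : ∀ i : Fin (m + 2), ∑ j : Fin m, w j * P j.succ.succ i = cr P i w := by
    intro i
    exact Finset.sum_congr rfl fun j _ => by rw [pd_symm hP i, mul_comm]
  have h0 := hc 0
  have h1 := hc 1
  simp only [QF, dotProduct, Matrix.mulVec, Fin.sum_univ_succ, toVec, Fin.cons_zero, Fin.cons_succ]
  have e1 : ((0 : Fin (m + 1)).succ : Fin (m + 2)) = 1 := rfl
  simp only [e1, mul_add, Finset.sum_add_distrib]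
  have k0 : ∑ j : Fin m, w j * (P j.succ.succ 0 * u) = u * cr P 0 w := by
    rw [← h0, Finset.mul_sum]
    exact Finset.sum_congr rfl fun j _ => by ring
  have k1 : ∑ j : Fin m, w j * (P j.succ.succ 1 * v) = v * cr P 1 w := by
    rw [← h1, Finset.mul_sum]
    exact Finset.sum_congr rfl fun j _ => by ring
  rw [k0, k1, h10]
  simp only [cr]
  simp
  ring

lemma sch_pos {m : ℕ} {S : Matrix (Fin (m + 2)) (Fin (m + 2)) ℝ} (hS : S.PosDef) :
    0 < S 1 1 - S 0 1 ^ 2 / S 0 0 := by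
  have h0 : 0 < S 0 0 := hS.diag_pos
  have h := QF_pos hS (-(S 0 1 / S 0 0), 1, 0) (by
    intro h
    have := congrArg (fun x : ℝ × ℝ × (Fin m → ℝ) => x.2.1) h
    simp at this)
  rw [QF_expand hS] at h
  have hq : QF S (0, 0, (0 : Fin m → ℝ)) = 0 := by
    have := QF_smul S 0 (0, 0, (0 : Fin m → ℝ))
    rw [zero_smul] at this
    refine Eq.trans this ?_
    ring
  rw [hq] at h
  simp only [cr, Pi.zero_apply, mul_zero, Finset.sum_const_zero] at h
  convert h using 1
  field_simp
  ring

lemma split12 {m : ℕ} {S : Matrix (Fin (m + 2)) (Fin (m + 2)) ℝ} (hS : S.PosDef) (u v : ℝ) :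
    ∃ ws : Fin m → ℝ, ∀ w, QF S⁻¹ (u, v, w) =
      u ^ 2 / S 0 0 + (v - S 0 1 / S 0 0 * u) ^ 2 / (S 1 1 - S 0 1 ^ 2 / S 0 0)
        + QF S⁻¹ (0, 0, w - ws) := by
  have h0 : 0 < S 0 0 := hS.diag_pos
  have hs := sch_pos hS
  set s := S 1 1 - S 0 1 ^ 2 / S 0 0 with hsd
  set β := S 0 1 / S 0 0 with hβ
  have hβ' : β * S 0 0 = S 0 1 := by rw [hβ]; field_simp
  have hs' : S 1 1 = s + β * S 0 1 := by rw [hsd, hβ]; ring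
  set r1 := (v - β * u) / s with hr1
  set r0 := u / S 0 0 - β * r1 with hr0
  have hr1' : r1 * s = v - β * u := by rw [hr1]; field_simp
  have hr0' : r0 * S 0 0 = u - r1 * S 0 1 := by
    rw [hr0, sub_mul, ← hβ']; field_simp
  set ρ := toVec (r0, r1, (0 : Fin m → ℝ)) with hρ
  set z := S *ᵥ ρ with hz
  have hPz : S⁻¹ *ᵥ z = ρ := by
    rw [hz, Matrix.mulVec_mulVec, Matrix.nonsing_inv_mul _ (isUnit_iff_ne_zero.mpr hS.det_pos.ne'),
      Matrix.one_mulVec]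
  have hzi : ∀ i, z i = S i 0 * r0 + S i 1 * r1 := by
    intro i
    rw [hz, hρ]
    simp only [dotProduct, Matrix.mulVec, Fin.sum_univ_succ, toVec, Fin.cons_zero, Fin.cons_succ]
    simp
  have hz0 : z 0 = u := by rw [hzi]; linarith
  have hz1 : z 1 = v := by
    rw [hzi, pd_symm hS 1 0, hs', ← hβ']
    have : r1 * s + β * (r0 * S 0 0 + r1 * S 0 1) = v := by rw [hr1', hr0']; ring
    rw [← hβ'] at this
    linarith
  refine ⟨fun i => z i.succ.succ, fun w => ?_⟩
  set d := toVec (0, 0, w - fun i => z i.succ.succ) with hd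
  have hx : toVec (u, v, w) = z + d := by
    conv_rhs => rw [toVec_eta z, hd, ← toVec_add, hz0, hz1]
    simp
  have hsym : ∀ a b : Fin (m + 2) → ℝ, a ⬝ᵥ (S⁻¹ *ᵥ b) = b ⬝ᵥ (S⁻¹ *ᵥ a) := by
    intro a b
    have ht : (S⁻¹)ᵀ = S⁻¹ := by
      ext i j
      exact pd_symm hS.inv j i
    rw [Matrix.dotProduct_mulVec, ← Matrix.mulVec_transpose, ht, dotProduct_comm]
  have hdρ : d ⬝ᵥ ρ = 0 := by
    rw [hd, hρ]
    simp [dotProduct, Fin.sum_univ_succ, toVec]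
  have hzρ : z ⬝ᵥ ρ = u * r0 + v * r1 := by
    rw [hρ, ← hz0, ← hz1]
    simp [dotProduct, Fin.sum_univ_succ, toVec]
  unfold QF
  rw [hx, Matrix.mulVec_add, dotProduct_add, add_dotProduct, add_dotProduct, hsym z d, hPz, hdρ, hzρ]
  have : u * r0 + v * r1 = u ^ 2 / S 0 0 + (v - β * u) ^ 2 / s := by
    rw [hr0, hr1]; field_simp; ring
  rw [this]
  ring

lemma gauss_eq {m : ℕ} (μ : Fin (m + 2) → ℝ) (S : Matrix (Fin (m + 2)) (Fin (m + 2)) ℝ)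
    (x : ℝ × ℝ × (Fin m → ℝ)) : gaussDens μ S x =
    (2 * Real.pi) ^ (-((m + 2 : ℕ) : ℝ) / 2) * S.det ^ (-(1 : ℝ) / 2) *
      Real.exp (-(1 / 2) * QF S⁻¹ (x - (μ 0, μ 1, fun i => μ i.succ.succ))) := by
  rw [gaussDens, QF, toVec_sub_mu]

lemma gauss_rapid {m : ℕ} (μ : Fin (m + 2) → ℝ) {S : Matrix (Fin (m + 2)) (Fin (m + 2)) ℝ}
    (hS : S.PosDef) : Rapid (gaussDens μ S) := by
  have h := rapid_exp (QF S⁻¹) (QF_cont _) (QF_smul _) (QF_pos hS.inv)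
    (μ 0, μ 1, fun i => μ i.succ.succ)
  have h2 := Rapid.mul (LinG.const
    ((2 * Real.pi) ^ (-((m + 2 : ℕ) : ℝ) / 2) * S.det ^ (-(1 : ℝ) / 2))) h
  convert h2 using 2 with x
  exact gauss_eq μ S x

lemma gauss_one {m : ℕ} (μ : Fin (m + 2) → ℝ) {S : Matrix (Fin (m + 2)) (Fin (m + 2)) ℝ}
    (hS : S.PosDef) : ∫ x, gaussDens μ S x = 1 := by
  simp_rw [gauss_eq]
  rw [integral_const_mul, integral_sub_right_eq_self (fun x => Real.exp (-(1 / 2) * QF S⁻¹ x))]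
  have h := toVec_integral (fun z : Fin (m + 2) → ℝ => Real.exp (-(1 / 2) * (z ⬝ᵥ (S⁻¹ *ᵥ z))))
  rw [gauss_full S hS] at h
  unfold QF
  rw [h]
  have hd := hS.det_pos
  rw [neg_div, neg_div, Real.rpow_neg (by positivity), Real.rpow_neg hd.le]
  have h1 : (2 * Real.pi) ^ (((m + 2 : ℕ) : ℝ) / 2) ≠ 0 := by positivity
  have h2 : S.det ^ ((1 : ℝ) / 2) ≠ 0 := by positivity
  field_simp

lemma cond_eq {m : ℕ} (μ : Fin (m + 2) → ℝ) {S : Matrix (Fin (m + 2)) (Fin (m + 2)) ℝ}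
    (hS : S.PosDef) (t v : ℝ) : rho2c (gaussDens μ S) t v =
      ProbabilityTheory.gaussianPDFReal (μ 1 + S 0 1 / S 0 0 * (t - μ 0))
        ⟨S 1 1 - S 0 1 ^ 2 / S 0 0, (sch_pos hS).le⟩ v := by
  have hs := sch_pos hS
  set s : NNReal := ⟨S 1 1 - S 0 1 ^ 2 / S 0 0, (sch_pos hS).le⟩ with hsd
  have hsv : (s : ℝ) = S 1 1 - S 0 1 ^ 2 / S 0 0 := rfl
  have hs0 : s ≠ 0 := by
    intro h
    have : (s : ℝ) = 0 := by rw [h]; rfl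
    linarith
  set K := (2 * Real.pi) ^ (-((m + 2 : ℕ) : ℝ) / 2) * S.det ^ (-(1 : ℝ) / 2) with hK
  have hKp : 0 < K := by
    have := hS.det_pos
    positivity
  set I := ∫ w : Fin m → ℝ, Real.exp (-(1 / 2) * QF S⁻¹ (0, 0, w)) with hI
  have hIp : 0 < I := by
    apply integral_exp_pos
    have h := (rapid_exp (QF S⁻¹) (QF_cont _) (QF_smul _) (QF_pos hS.inv) 0).comp
      (φ := fun w : Fin m → ℝ => (0, 0, w)) (by fun_prop) (fun p => by simp [Prod.norm_def])
    have := h.integrable (ν := volume)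
    simpa using this
  have hsq : 0 < √(2 * Real.pi * s) := by
    have : 0 < (s : ℝ) := by rw [hsv]; exact hs
    positivity
  have h12 : ∀ v, rho12 (gaussDens μ S) t v =
      (K * I * Real.exp (-(1 / 2) * ((t - μ 0) ^ 2 / S 0 0)) * √(2 * Real.pi * s)) *
      ProbabilityTheory.gaussianPDFReal (μ 1 + S 0 1 / S 0 0 * (t - μ 0)) s v := by
    intro v
    obtain ⟨ws, hws⟩ := split12 hS (t - μ 0) (v - μ 1)
    have hg : ∀ y, gaussDens μ S (t, v, y) = (K * Real.exp (-(1 / 2) * ((t - μ 0) ^ 2 / S 0 0)) *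
        Real.exp (-(v - (μ 1 + S 0 1 / S 0 0 * (t - μ 0))) ^ 2 / (2 * (s : ℝ)))) *
        Real.exp (-(1 / 2) * QF S⁻¹ (0, 0, y - ((fun i => μ i.succ.succ) + ws))) := by
      intro y
      rw [gauss_eq, ← hK, mul_assoc K, mul_assoc K, ← Real.exp_add, ← Real.exp_add]
      simp only [Prod.mk_sub_mk]
      rw [hws, sub_sub y, ← hsv]
      congr 2
      have : (s : ℝ) ≠ 0 := by rw [hsv]; exact hs.ne'
      have : S 0 0 ≠ 0 := (hS.diag_pos).ne'
      field_simp
      ring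
    unfold rho12
    simp_rw [hg]
    rw [integral_const_mul,
      integral_sub_right_eq_self (fun w => Real.exp (-(1 / 2) * QF S⁻¹ (0, 0, w))), ← hI,
      ProbabilityTheory.gaussianPDFReal]
    field_simp
  have h1 : rho1 (gaussDens μ S) t = ∫ v, rho12 (gaussDens μ S) t v := by
    have h := ((gauss_rapid μ hS).comp (φ := fun p : ℝ × (Fin m → ℝ) => (t, p)) (by fun_prop)
      (fun p => by simp [Prod.norm_def])).integrable (ν := volume)
    unfold rho1 rho12
    rw [Measure.volume_eq_prod] at h ⊢
    rw [integral_prod _ h]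
  rw [rho2c, h1]
  simp_rw [h12]
  rw [integral_const_mul, ProbabilityTheory.integral_gaussianPDFReal_eq_one _ hs0]
  field_simp

lemma rhoM2_one {m : ℕ} (μ : Fin (m + 2) → ℝ) {S : Matrix (Fin (m + 2)) (Fin (m + 2)) ℝ}
    (hS : S.PosDef)
    (hi : Integrable (fun z : ℝ × (Fin m → ℝ) => rhoM2 (gaussDens μ S) z.1 z.2)) :
    ∫ z : ℝ × (Fin m → ℝ), rhoM2 (gaussDens μ S) z.1 z.2 = 1 := by
  have h := (gauss_rapid μ hS).integrable (ν := volume)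
  rw [← gauss_one μ hS]
  rw [Measure.volume_eq_prod] at h hi ⊢
  rw [Measure.volume_eq_prod, integral_prod _ hi, integral_prod _ h]
  refine integral_congr_ae (Eventually.of_forall fun t => ?_)
  have h2 := ((gauss_rapid μ hS).comp (φ := fun p : ℝ × (Fin m → ℝ) => (t, p)) (by fun_prop)
      (fun p => by simp [Prod.norm_def])).integrable (ν := volume)
  rw [Measure.volume_eq_prod] at h2
  simp only
  rw [Measure.volume_eq_prod, integral_prod_symm _ h2]
  rfl

lemma rhoM2_eq {m : ℕ} (μ : Fin (m + 2) → ℝ) {S : Matrix (Fin (m + 2)) (Fin (m + 2)) ℝ}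
    (hS : S.PosDef) : ∃ K : ℝ, ∀ t y, rhoM2 (gaussDens μ S) t y =
      K * Real.exp (-(1 / 2) * ((S⁻¹ 0 0 - S⁻¹ 0 1 ^ 2 / S⁻¹ 1 1) * (t - μ 0) ^ 2 +
        2 * (t - μ 0) * (cr S⁻¹ 0 (y - fun i => μ i.succ.succ) -
          S⁻¹ 0 1 / S⁻¹ 1 1 * cr S⁻¹ 1 (y - fun i => μ i.succ.succ)) +
        (QF S⁻¹ (0, 0, y - fun i => μ i.succ.succ) -
          cr S⁻¹ 1 (y - fun i => μ i.succ.succ) ^ 2 / S⁻¹ 1 1))) := by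
  have hP := hS.inv
  have h11 : 0 < S⁻¹ 1 1 := hP.diag_pos
  set K := (2 * Real.pi) ^ (-((m + 2 : ℕ) : ℝ) / 2) * S.det ^ (-(1 : ℝ) / 2) with hK
  refine ⟨K * ∫ v : ℝ, Real.exp (-(1 / 2) * (S⁻¹ 1 1 * v ^ 2)), fun t y => ?_⟩
  have hg : ∀ v, gaussDens μ S (t, v, y) = (K * Real.exp (-(1 / 2) *
      ((S⁻¹ 0 0 - S⁻¹ 0 1 ^ 2 / S⁻¹ 1 1) * (t - μ 0) ^ 2 +
        2 * (t - μ 0) * (cr S⁻¹ 0 (y - fun i => μ i.succ.succ) -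
          S⁻¹ 0 1 / S⁻¹ 1 1 * cr S⁻¹ 1 (y - fun i => μ i.succ.succ)) +
        (QF S⁻¹ (0, 0, y - fun i => μ i.succ.succ) -
          cr S⁻¹ 1 (y - fun i => μ i.succ.succ) ^ 2 / S⁻¹ 1 1)))) *
      Real.exp (-(1 / 2) * (S⁻¹ 1 1 * (v - (μ 1 - (S⁻¹ 0 1 * (t - μ 0) +
        cr S⁻¹ 1 (y - fun i => μ i.succ.succ)) / S⁻¹ 1 1)) ^ 2)) := by
    intro v
    rw [gauss_eq, ← hK, mul_assoc K, ← Real.exp_add]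
    simp only [Prod.mk_sub_mk]
    rw [QF_expand hP]
    congr 2
    field_simp
    ring
  unfold rhoM2
  simp_rw [hg]
  rw [integral_const_mul,
    integral_sub_right_eq_self (fun v => Real.exp (-(1 / 2) * (S⁻¹ 1 1 * v ^ 2)))]
  ring

/-- Theorem 4, linear–Gaussian case: for a Gaussian density with
covariance Σ, affine F₁(x) = f₁ + Σₖ a_{1k} xₖ and constant g₁₁, the information
flow from the second to the first coordinate equals a₁₂ Σ₁₂/Σ₁₁. -/
theorem information_flow_linear_gaussian
    (m : ℕ) (hm : 1 ≤ m)
    (μ : Fin (m + 2) → ℝ)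
    (S : Matrix (Fin (m + 2)) (Fin (m + 2)) ℝ)
    (hS : S.PosDef)
    (f₁ : ℝ) (a : Fin (m + 2) → ℝ) (g₁₁ : ℝ) :
    -(∫ x : ℝ × ℝ × (Fin m → ℝ),
        rho2c (gaussDens μ S) x.1 x.2.1
          * deriv (fun t =>
              (f₁ + ∑ k, a k * toVec (t, x.2.1, x.2.2) k)
                * rhoM2 (gaussDens μ S) t x.2.2) x.1)
      + (1/2) * ∫ x : ℝ × ℝ × (Fin m → ℝ),
          rho2c (gaussDens μ S) x.1 x.2.1
            * deriv (deriv (fun t => g₁₁ * rhoM2 (gaussDens μ S) t x.2.2)) x.1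
      = a 1 * S 0 1 / S 0 0 := by
  have hP := hS.inv
  have h11 : 0 < S⁻¹ 1 1 := hP.diag_pos
  obtain ⟨K, hK⟩ := rhoM2_eq μ hS
  have hs0 : (⟨S 1 1 - S 0 1 ^ 2 / S 0 0, (sch_pos hS).le⟩ : NNReal) ≠ 0 := by
    intro h
    have h2 := congrArg NNReal.toReal h
    have h3 := sch_pos hS
    exact h3.ne' h2
  have core := flow_core (S⁻¹ 0 0 - S⁻¹ 0 1 ^ 2 / S⁻¹ 1 1) (S 0 1 / S 0 0) K (μ 0) (μ 1)
    f₁ (a 0) (a 1) hs0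
    (fun w => cr S⁻¹ 0 w - S⁻¹ 0 1 / S⁻¹ 1 1 * cr S⁻¹ 1 w)
    (fun w => QF S⁻¹ (0, 0, w) - cr S⁻¹ 1 w ^ 2 / S⁻¹ 1 1)
    (fun w => ∑ k : Fin m, a k.succ.succ * w k)
    (fun i => μ i.succ.succ)
    (fun x y => by simp only [cr_add]; ring)
    (fun c x => by simp only [cr_smul]; ring)
    (fun x y => by simp [mul_add, Finset.sum_add_distrib])
    (fun c x => by
      simp only [Pi.smul_apply, smul_eq_mul, Finset.mul_sum]
      exact Finset.sum_congr rfl fun j _ => by ring)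
    (by
      have h1 := QF_cont S⁻¹
      unfold cr
      fun_prop)
    (fun c x => by
      have h1 := QF_smul S⁻¹ c (0, 0, x)
      simp only [Prod.smul_mk, smul_zero] at h1
      rw [h1, cr_smul]
      ring)
    (fun u w huw => by
      have h1 := QF_pos hP (u, -(S⁻¹ 0 1 * u + cr S⁻¹ 1 w) / S⁻¹ 1 1, w) (by
        intro h
        apply huw
        have h2 := congrArg (fun x : ℝ × ℝ × (Fin m → ℝ) => x.1) h
        have h3 := congrArg (fun x : ℝ × ℝ × (Fin m → ℝ) => x.2.2) h
        exact Prod.ext h2 h3)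
      rw [QF_expand hP] at h1
      refine lt_of_lt_of_eq h1 ?_
      field_simp
      ring)
    (rhoM2 (gaussDens μ S)) (rho2c (gaussDens μ S)) hK (cond_eq μ hS) (rhoM2_one μ hS)
  have hsum : ∀ (t v : ℝ) (y : Fin m → ℝ), f₁ + ∑ k, a k * toVec (t, v, y) k =
      f₁ + (a 0 * t + (a 1 * v + ∑ k : Fin m, a k.succ.succ * y k)) := by
    intro t v y
    simp [Fin.sum_univ_succ, toVec]
  simp_rw [hsum]
  rw [core.1, core.2 g₁₁]
  ring
end
end
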